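/- Fix k > 0, κ > 0 with κ ≠ k, and L > 0 with sin(kL) ≠ 0. Define κ̃(Δx) = sin(κΔx/2)/(Δx/2) and k̃(Δx) = (2/Δx) arcsin(kΔx/2), and the relative amplitude error ℰ_A(Δx) = [(k^2 − κ^2)/(k^2 − κ̃(Δx)^2)] · [sin(kL)/sin(k̃(Δx)L)] − 1. Then as Δx → 0⁺, ℰ_A(Δx) = −[κ^4/(12(k^2 − κ^2)) + k^3 L cos(kL)/(24 sin(kL))] Δx^2 + O(Δx^4). -/

import Mathlib

open Real Filter Asymptotics Topology

/-- `f h = a + b * h ^ 2 + O(h ^ 4)` as `h → 0⁺`. -/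
def HasEvenExpansion (f : ℝ → ℝ) (a b : ℝ) : Prop :=
  (fun h : ℝ => f h - (a + b * h ^ 2)) =O[𝓝[>] (0 : ℝ)] fun h : ℝ => h ^ 4

lemma isBigO_one_nhdsGT {f : ℝ → ℝ} (hf : Continuous f) :
    f =O[𝓝[>] (0 : ℝ)] fun _ : ℝ => (1 : ℝ) :=
  ((hf.tendsto 0).mono_left nhdsWithin_le_nhds).isBigO_one ℝ

lemma HasEvenExpansion.tendsto {f : ℝ → ℝ} {a b : ℝ} (hf : HasEvenExpansion f a b) :
    Tendsto f (𝓝[>] 0) (𝓝 a) := by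
  have h4 : Tendsto (fun h : ℝ => h ^ 4) (𝓝[>] 0) (𝓝 0) := by
    have : Continuous fun h : ℝ => h ^ 4 := by fun_prop
    simpa using (this.tendsto 0).mono_left nhdsWithin_le_nhds
  have hp : Tendsto (fun h : ℝ => a + b * h ^ 2) (𝓝[>] 0) (𝓝 a) := by
    have : Continuous fun h : ℝ => a + b * h ^ 2 := by fun_prop
    simpa using (this.tendsto 0).mono_left nhdsWithin_le_nhds
  simpa using (hf.trans_tendsto h4).add hp

lemma HasEvenExpansion.const (a : ℝ) : HasEvenExpansion (fun _ => a) a 0 := by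
  simpa [HasEvenExpansion] using isBigO_zero _ _

lemma HasEvenExpansion.sub {f g : ℝ → ℝ} {a b c d : ℝ} (hf : HasEvenExpansion f a b)
    (hg : HasEvenExpansion g c d) :
    HasEvenExpansion (fun h => f h - g h) (a - c) (b - d) :=
  (IsBigO.sub hf hg).congr_left fun h => by ring

lemma HasEvenExpansion.mul {f g : ℝ → ℝ} {a b c d : ℝ} (hf : HasEvenExpansion f a b)
    (hg : HasEvenExpansion g c d) :
    HasEvenExpansion (fun h => f h * g h) (a * c) (a * d + b * c) := by
  have h1 := IsBigO.mul hf (hg.tendsto.isBigO_one ℝ)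
  have h2 := IsBigO.mul
    (isBigO_one_nhdsGT (f := fun h : ℝ => a + b * h ^ 2) (by fun_prop)) hg
  have h3 : (fun h : ℝ => b * d * h ^ 4) =O[𝓝[>] (0 : ℝ)] fun h : ℝ => h ^ 4 :=
    isBigO_const_mul_self _ _ _
  simp only [mul_one, one_mul] at h1 h2
  exact ((h1.add h2).add h3).congr_left fun h => by ring

lemma HasEvenExpansion.inv {f : ℝ → ℝ} {a b : ℝ} (hf : HasEvenExpansion f a b)
    (ha : a ≠ 0) : HasEvenExpansion (fun h => (f h)⁻¹) a⁻¹ (-b / a ^ 2) := by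
  have hp : HasEvenExpansion (fun h => a⁻¹ + -b / a ^ 2 * h ^ 2) a⁻¹ (-b / a ^ 2) := by
    simpa [HasEvenExpansion] using isBigO_zero _ _
  have h1 := (HasEvenExpansion.const 1).sub (hf.mul hp)
  have h2 := IsBigO.mul ((hf.tendsto.inv₀ ha).isBigO_one ℝ) h1
  simp only [one_mul] at h2
  refine h2.congr' ?_ EventuallyEq.rfl
  filter_upwards [hf.tendsto.eventually_ne ha] with h hh
  field_simp
  ring

lemma isBigO_pow_succ_of_hasDerivAt {f f' : ℝ → ℝ} {n : ℕ}
    (hf : ∀ᶠ x in 𝓝 0, HasDerivAt f (f' x) x) (h0 : f 0 = 0)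
    (hf' : f' =O[𝓝 0] fun x : ℝ => x ^ n) : f =O[𝓝 0] fun x : ℝ => x ^ (n + 1) := by
  obtain ⟨C, hC⟩ := hf'.bound
  obtain ⟨ε, hε, hball⟩ := Metric.eventually_nhds_iff_ball.1 (hf.and hC)
  refine IsBigO.of_bound C ?_
  filter_upwards [Metric.ball_mem_nhds (0 : ℝ) hε] with x hx
  have key : ∀ y ∈ segment ℝ 0 x, |y| ≤ |x| := by
    rintro y ⟨s, t, hs, ht, hst, rfl⟩
    simp only [smul_eq_mul, mul_zero, zero_add, abs_mul, abs_of_nonneg ht]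
    exact mul_le_of_le_one_left (abs_nonneg x) (by linarith)
  have hmem : ∀ y ∈ segment ℝ 0 x, y ∈ Metric.ball (0 : ℝ) ε := fun y hy => by
    have := key y hy
    simp only [mem_ball_zero_iff, Real.norm_eq_abs] at hx ⊢
    linarith
  by_cases hx0 : x = 0
  · simp [hx0, h0]
  have hC0 : 0 ≤ C := by
    have := (norm_nonneg _).trans (hball x hx).2
    have hpos : 0 < ‖x ^ n‖ := norm_pos_iff.2 (pow_ne_zero n hx0)
    exact nonneg_of_mul_nonneg_left this hpos
  have := (convex_segment (0 : ℝ) x).norm_image_sub_le_of_norm_hasDerivWithin_le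
    (f := f) (f' := f') (C := C * |x| ^ n)
    (fun y hy => (hball y (hmem y hy)).1.hasDerivWithinAt)
    (fun y hy => (hball y (hmem y hy)).2.trans (by
      rw [norm_pow, Real.norm_eq_abs]
      have := key y hy
      gcongr))
    (left_mem_segment ℝ 0 x) (right_mem_segment ℝ 0 x)
  simpa [h0, pow_succ, mul_assoc] using this

lemma sin_sub_cubic_isBigO :
    (fun x : ℝ => Real.sin x - (x - x ^ 3 / 6)) =O[𝓝 0] fun x : ℝ => x ^ 5 := by
  refine isBigO_pow_succ_of_hasDerivAt (n := 4)
    (f' := fun x => Real.cos x - (1 - x ^ 2 / 2)) (Eventually.of_forall fun x => ?_)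
    (by simp) (IsBigO.of_bound (5 / 96) ?_)
  · refine ((Real.hasDerivAt_sin x).sub
      ((hasDerivAt_id x).sub ((hasDerivAt_pow 3 x).div_const 6))).congr_deriv ?_
    norm_num
    ring
  · filter_upwards [Metric.ball_mem_nhds (0 : ℝ) one_pos] with x hx
    rw [mem_ball_zero_iff, Real.norm_eq_abs] at hx
    simpa [mul_comm] using Real.cos_bound hx.le

lemma arcsin_sub_cubic_isBigO :
    (fun x : ℝ => Real.arcsin x - (x + x ^ 3 / 6)) =O[𝓝 0] fun x : ℝ => x ^ 5 := by
  have hy : (fun y : ℝ => y - (Real.sin y + Real.sin y ^ 3 / 6)) =O[𝓝 0]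
      fun y : ℝ => y ^ 5 := by
    have hs := sin_sub_cubic_isBigO
    have hq : (fun y : ℝ => Real.sin y ^ 2 + Real.sin y * (y - y ^ 3 / 6) +
        (y - y ^ 3 / 6) ^ 2) =O[𝓝 0] fun _ : ℝ => (1 : ℝ) :=
      (Continuous.tendsto (by fun_prop) 0).isBigO_one ℝ
    have hr : (fun y : ℝ => (1 / 12 - y ^ 2 / 72 + y ^ 4 / 1296) * y ^ 5) =O[𝓝 0]
        fun y : ℝ => y ^ 5 := by
      have h1 : (fun y : ℝ => 1 / 12 - y ^ 2 / 72 + y ^ 4 / 1296) =O[𝓝 0]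
          fun _ : ℝ => (1 : ℝ) := (Continuous.tendsto (by fun_prop) 0).isBigO_one ℝ
      simpa using h1.mul (isBigO_refl (fun y : ℝ => y ^ 5) _)
    have hm := (hs.mul hq).const_mul_left (1 / 6)
    simp only [mul_one] at hm
    exact ((hr.sub hs).sub hm).congr_left fun y => by ring
  have ht : Tendsto Real.arcsin (𝓝 0) (𝓝 0) := by
    simpa using Real.continuous_arcsin.tendsto 0
  have ho : Real.arcsin =O[𝓝 0] fun x : ℝ => x := by
    simpa using (Real.hasDerivAt_arcsin (x := 0) (by norm_num) (by norm_num)).isBigO_sub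
  refine ((hy.comp_tendsto ht).trans (ho.pow 5)).congr' ?_ EventuallyEq.rfl
  filter_upwards [Metric.ball_mem_nhds (0 : ℝ) one_pos] with x hx
  rw [mem_ball_zero_iff, Real.norm_eq_abs, abs_lt] at hx
  simp [Real.sin_arcsin hx.1.le hx.2.le]

lemma HasEvenExpansion.of_cubic {g : ℝ → ℝ} {d : ℝ}
    (hg : (fun x : ℝ => g x - (x + d * x ^ 3)) =O[𝓝 0] fun x : ℝ => x ^ 5) (c : ℝ) :
    HasEvenExpansion (fun h => g (c * h / 2) / (h / 2)) c (d * c ^ 3 / 4) := by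
  have ht : Tendsto (fun h : ℝ => c * h / 2) (𝓝[>] 0) (𝓝 0) := by
    have : Continuous fun h : ℝ => c * h / 2 := by fun_prop
    simpa using (this.tendsto 0).mono_left nhdsWithin_le_nhds
  have h1 := (hg.comp_tendsto ht).mul
    (isBigO_refl (fun h : ℝ => (h / 2)⁻¹) (𝓝[>] 0))
  have h2 : (fun h : ℝ => (c ^ 5 / 16) * h ^ 4) =O[𝓝[>] (0 : ℝ)] fun h : ℝ => h ^ 4 :=
    isBigO_const_mul_self _ _ _
  refine (h1.congr' ?_ ?_).trans h2
  all_goals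
    filter_upwards [self_mem_nhdsWithin] with h hh
    have : h ≠ 0 := ne_of_gt hh
    simp only [Function.comp_apply]
    field_simp
    try ring

lemma sin_sub_linear_isBigO (a : ℝ) :
    (fun x : ℝ => Real.sin (a + x) - Real.sin a - Real.cos a * x) =O[𝓝 0]
      fun x : ℝ => x ^ 2 := by
  refine isBigO_pow_succ_of_hasDerivAt (n := 1)
    (f' := fun x => Real.cos (a + x) - Real.cos a) (Eventually.of_forall fun x => ?_)
    (by simp) ?_
  · exact ((((hasDerivAt_id x).const_add a).sin.sub_const (Real.sin a)).sub
      ((hasDerivAt_id x).const_mul (Real.cos a))).congr_deriv (by simp)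
  · have : HasDerivAt (fun x => Real.cos (a + x)) (-Real.sin (a + 0) * 1) 0 :=
      ((hasDerivAt_id (0 : ℝ)).const_add a).cos
    simpa using this.isBigO_sub

lemma HasEvenExpansion.sin {f : ℝ → ℝ} {a b : ℝ} (hf : HasEvenExpansion f a b) :
    HasEvenExpansion (fun h => Real.sin (f h)) (Real.sin a) (Real.cos a * b) := by
  have ht : Tendsto (fun h => f h - a) (𝓝[>] 0) (𝓝 0) := by
    simpa using hf.tendsto.sub_const a
  have hsq : (fun h => (f h - a) ^ 2) =O[𝓝[>] (0 : ℝ)] fun h : ℝ => h ^ 4 := by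
    have hd := hf.sub (HasEvenExpansion.const a)
    exact (hd.mul hd).congr_left fun h => by ring
  have h1 := ((sin_sub_linear_isBigO a).comp_tendsto ht).trans hsq
  refine (h1.add (IsBigO.const_mul_left hf (Real.cos a))).congr_left fun h => ?_
  simp only [Function.comp, add_sub_cancel]
  ring

theorem relative_amplitude_error_expansion (k κ L : ℝ) (hk : 0 < k) (hκ : 0 < κ)
    (hkκ : κ ≠ k) (hL : 0 < L) (hsin : Real.sin (k * L) ≠ 0)
    (κt kt EA : ℝ → ℝ)
    (hκt : ∀ Δx : ℝ, κt Δx = Real.sin (κ * Δx / 2) / (Δx / 2))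
    (hkt : ∀ Δx : ℝ, kt Δx = (2 / Δx) * Real.arcsin (k * Δx / 2))
    (hEA : ∀ Δx : ℝ, EA Δx =
        ((k ^ 2 - κ ^ 2) / (k ^ 2 - κt Δx ^ 2)) *
          (Real.sin (k * L) / Real.sin (kt Δx * L)) - 1) :
    (fun Δx : ℝ =>
        EA Δx -
          (-(κ ^ 4 / (12 * (k ^ 2 - κ ^ 2)) +
              k ^ 3 * L * Real.cos (k * L) / (24 * Real.sin (k * L))) * Δx ^ 2))
      =O[𝓝[>] (0 : ℝ)] fun Δx : ℝ => Δx ^ 4 := by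
  have hden : k ^ 2 - κ ^ 2 ≠ 0 := by
    rw [sub_ne_zero, Ne, sq_eq_sq₀ hk.le hκ.le]
    exact hkκ.symm
  have h1 : HasEvenExpansion κt κ (-(1 / 6) * κ ^ 3 / 4) := by
    rw [funext hκt]
    exact HasEvenExpansion.of_cubic (sin_sub_cubic_isBigO.congr_left fun x => by ring) κ
  have h2 : HasEvenExpansion kt k (1 / 6 * k ^ 3 / 4) := by
    have := HasEvenExpansion.of_cubic
      (arcsin_sub_cubic_isBigO.congr_left fun x => by ring) k (d := 1 / 6)
    convert this using 2 with h
    rw [hkt, div_div_eq_mul_div]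
    ring
  have h3 := ((HasEvenExpansion.const (k ^ 2)).sub (h1.mul h1)).inv
    (by rwa [← sq])
  have h4 := (h2.mul (HasEvenExpansion.const L)).sin.inv hsin
  have h5 := (((HasEvenExpansion.const (k ^ 2 - κ ^ 2)).mul h3).mul
    ((HasEvenExpansion.const (Real.sin (k * L))).mul h4)).sub (HasEvenExpansion.const 1)
  refine h5.congr_left fun h => ?_
  rw [hEA]
  simp only [← sq]
  field_simp
  ring
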